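/- Let A, B, C be abelian categories and U : A → C, V : B → C functors, where U has a right adjoint and V is left exact. Then the map f : ASpec A ⊔ ASpec B → ASpec(U ↓ V) given by ⟨H⟩ ↦ ⟨S_A H⟩ for ⟨H⟩ ∈ ASpec A and ⟨H⟩ ↦ ⟨S_B H⟩ for ⟨H⟩ ∈ ASpec B is a homeomorphism with respect to the localization topologies and an order-isomorphism with respect to the specialization orders. -/

import Mathlib

/-!
Basic notions from Kanda's theory of atoms in abelian categories.
-/

open CategoryTheory CategoryTheory.Limits

namespace AtomSpectrum

variable {C : Type*} [Category C] [Abelian C]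

/-- An object `H` of an abelian category is *monoform* if `H ≠ 0` and for every non-zero
subobject `N ↣ H` there is no common non-zero subobject of `H` and `H/N`; that is, whenever
there are monomorphisms `H ↢ X ↣ H/N`, then `X = 0`. -/
def Monoform (H : C) : Prop :=
  ¬ IsZero H ∧
    ∀ (N : Subobject H), ¬ IsZero (N : C) →
      ∀ (X : C) (f : X ⟶ H) (g : X ⟶ cokernel N.arrow), Mono f → Mono g → IsZero X

/-- Two objects are *atom equivalent* if they have a common non-zero subobject. -/
def AtomEquiv (H H' : C) : Prop :=
  ∃ (M : C) (f : M ⟶ H) (g : M ⟶ H'), Mono f ∧ Mono g ∧ ¬ IsZero M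

variable (C) in
/-- The *atom spectrum* of an abelian category: atom-equivalence classes of monoform objects. -/
def ASpec : Type _ :=
  Quot (fun H H' : {H : C // Monoform H} => AtomEquiv H.1 H'.1)

/-- The atom `⟨H⟩` determined by a monoform object `H`. -/
def atom (H : C) (h : Monoform H) : ASpec C := Quot.mk _ ⟨H, h⟩

/-- The *atom support* of an object `M`: all atoms `⟨H⟩` where `H` is a monoform subquotient
`L/L'` of `M` (for subobjects `L' ⊆ L ⊆ M`). -/
def ASupp (M : C) : Set (ASpec C) :=
  {α | ∃ (H : C) (h : Monoform H), atom H h = α ∧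
    ∃ (L : Subobject M) (L' : Subobject (L : C)), Nonempty (H ≅ cokernel L'.arrow)}

/-- The localization topology on the atom spectrum: a set `Φ` is open iff for every
`⟨H⟩ ∈ Φ` there is some `H'` atom equivalent to `H` with `ASupp H' ⊆ Φ`. -/
instance : TopologicalSpace (ASpec C) :=
  TopologicalSpace.generateFrom
    {Φ | ∀ (H : C) (h : Monoform H), atom H h ∈ Φ →
      ∃ (H' : C) (_ : Monoform H'), AtomEquiv H' H ∧ ASupp H' ⊆ Φ}

end AtomSpectrum

namespace CategoryTheory.Functor

open CategoryTheory

variable {A : Type*} {B : Type*} [Category A] [Category B]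

/-- A functor `F : A ⥤ B` *lifts subobjects* if every monomorphism `ι : Y ↣ F.obj X` is,
up to isomorphism, of the form `F.map ι'` for a monomorphism `ι' : X' ↣ X`. -/
def LiftsSubobjects (F : A ⥤ B) : Prop :=
  ∀ (X : A) (Y : B) (ι : Y ⟶ F.obj X), Mono ι →
    ∃ (X' : A) (ι' : X' ⟶ X), Mono ι' ∧ ∃ e : Y ≅ F.obj X', e.hom ≫ F.map ι' = ι

/-- An additive functor between abelian categories is *exact* if it preserves finite limits
and finite colimits. -/
def IsExact (F : A ⥤ B) : Prop :=
  Nonempty (Limits.PreservesFiniteLimits F) ∧ Nonempty (Limits.PreservesFiniteColimits F)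

end CategoryTheory.Functor
namespace CommaAbelian

open CategoryTheory CategoryTheory.Limits ZeroObject

variable {A B C : Type*} [Category A] [Category B] [Category C]
variable [Abelian A] [Abelian B] [Abelian C]
variable (U : A ⥤ C) (V : B ⥤ C) [U.Additive] [V.Additive]

/-- The stalk functor `S_A : A ⥤ (U ↓ V)`, `X ↦ (X, 0, 0)`. -/
noncomputable def stalkLeft : A ⥤ Comma U V where
  obj X := { left := X, right := 0, hom := 0 }
  map f := { left := f, right := 𝟙 0, w := by simp }
  map_id X := by ext <;> simp
  map_comp f g := by ext <;> simp

/-- The stalk functor `S_B : B ⥤ (U ↓ V)`, `Y ↦ (0, Y, 0)`. -/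
noncomputable def stalkRight : B ⥤ Comma U V where
  obj Y := { left := 0, right := Y, hom := 0 }
  map g := { left := 𝟙 0, right := g, w := by simp }
  map_id Y := by ext <;> simp
  map_comp f g := by ext <;> simp

end CommaAbelian

open CategoryTheory CategoryTheory.Limits CommaAbelian AtomSpectrum

namespace AtomSpectrum

section Basic

variable {D : Type*} [Category D]

lemma AtomEquiv.symm {H H' : D} : AtomEquiv H H' → AtomEquiv H' H :=
  fun ⟨M, f, g, hf, hg, hM⟩ => ⟨M, g, f, hg, hf, hM⟩

lemma AtomEquiv.of_mono {H H' : D} (f : H ⟶ H') [Mono f] (h0 : ¬ IsZero H) : AtomEquiv H H' :=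
  ⟨H, 𝟙 H, f, inferInstance, inferInstance, h0⟩

variable [Abelian D]

lemma exists_fac_of_eq_zero {X Y : D} {f : X ⟶ Y} (hf : f = 0) (Z : D) :
    ∃ (a : X ⟶ Z) (b : Z ⟶ Y), a ≫ b = f :=
  ⟨0, 0, by rw [hf, comp_zero]⟩

lemma isZero_of_mono_to_isZero {X Y : D} (f : X ⟶ Y) [Mono f] (hY : IsZero Y) : IsZero X := by
  rw [IsZero.iff_id_eq_zero, ← cancel_mono f]
  exact hY.eq_of_tgt _ _

/-- Cokernels of isomorphic monomorphisms are isomorphic. -/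
lemma nonempty_iso_of_shortExact {N N' H Q Q' : D} {i : N ⟶ H} {i' : N' ⟶ H}
    {p : H ⟶ Q} {p' : H ⟶ Q'} {w : i ≫ p = 0} {w' : i' ≫ p' = 0}
    (h : (ShortComplex.mk i p w).ShortExact) (h' : (ShortComplex.mk i' p' w').ShortExact)
    (e : N ≅ N') (he : e.hom ≫ i' = i) : Nonempty (Q ≅ Q') :=
  ⟨h.gIsCokernel.coconePointUniqueUpToIso
    (isCokernelEpiComp h'.gIsCokernel e.hom he.symm)⟩

lemma shortExact_cokernel {N H : D} (i : N ⟶ H) [Mono i] :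
    (ShortComplex.mk i (cokernel.π i) (cokernel.condition i)).ShortExact :=
  .mk' (ShortComplex.exact_cokernel i) inferInstance inferInstance

lemma shortExact_kernel {H Q : D} (p : H ⟶ Q) [Epi p] :
    (ShortComplex.mk (kernel.ι p) p (kernel.condition p)).ShortExact :=
  .mk' (ShortComplex.exact_kernel p) inferInstance inferInstance

/-- Monoformity, tested on arbitrary short exact sequences. -/
lemma monoform_iff {H : D} : Monoform H ↔ ¬ IsZero H ∧
    ∀ (N Q : D) (i : N ⟶ H) (p : H ⟶ Q) (w : i ≫ p = 0), (ShortComplex.mk i p w).ShortExact →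
      ¬ IsZero N → ∀ (X : D) (f : X ⟶ H) (g : X ⟶ Q), Mono f → Mono g → IsZero X := by
  refine and_congr_right fun _ => ⟨fun h N Q i p w hs hN X f g hf hg => ?_,
    fun h N hN => h _ _ N.arrow _ _ (shortExact_cokernel _) hN⟩
  have : Mono i := hs.mono_f
  obtain ⟨e⟩ := nonempty_iso_of_shortExact hs (shortExact_cokernel (Subobject.mk i).arrow)
    (Subobject.underlyingIso i).symm (by simp)
  exact h (Subobject.mk i) (fun hz => hN (hz.of_iso (Subobject.underlyingIso i).symm)) X f
    (g ≫ e.hom) hf (mono_comp _ _)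

/-- Non-zero subobjects of a monoform object are monoform. -/
lemma Monoform.of_mono {H H' : D} (h : Monoform H) (j : H' ⟶ H) [Mono j] (h0 : ¬ IsZero H') :
    Monoform H' := by
  refine ⟨h0, fun N hN X f g hf hg => ?_⟩
  have sq : IsPullback N.arrow (𝟙 _) j (N.arrow ≫ j) := by
    refine ⟨⟨by simp⟩, ⟨PullbackCone.IsLimit.mk _ (fun s => s.snd) (fun s => ?_) (fun s => by simp)
      (fun s m _ hm => by simpa using hm)⟩⟩
    rw [← cancel_mono j]
    simpa using s.condition.symm
  have := Abelian.mono_cokernel_map_of_isPullback sq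
  exact (monoform_iff.1 h).2 _ _ _ _ _ (shortExact_cokernel (N.arrow ≫ j)) hN X (f ≫ j)
    (g ≫ cokernel.map _ _ _ _ sq.w) (mono_comp _ _) (mono_comp _ _)

/-- Monoform objects are uniform: non-zero subobjects meet in a non-zero subobject. -/
lemma Monoform.not_isZero_pullback {H M N : D} (h : Monoform H) (f : M ⟶ H) (g : N ⟶ H)
    [Mono f] [Mono g] (hM : ¬ IsZero M) (hN : ¬ IsZero N) : ¬ IsZero (pullback f g) := by
  intro hz
  refine hM ((monoform_iff.1 h).2 _ _ _ _ _ (shortExact_cokernel g) hN M f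
    (f ≫ cokernel.π g) inferInstance (Preadditive.mono_of_cancel_zero _ fun {Z} u hu => ?_))
  rw [← Category.assoc] at hu
  let v := (shortExact_cokernel g).exact.lift _ hu
  have hv : v ≫ g = u ≫ f := (shortExact_cokernel g).exact.lift_f _ hu
  rw [← pullback.lift_fst u v hv.symm, hz.eq_of_src (pullback.fst f g) 0, comp_zero]

lemma AtomEquiv.trans {H H' H'' : D} (h : Monoform H') :
    AtomEquiv H H' → AtomEquiv H' H'' → AtomEquiv H H'' := by
  rintro ⟨M, f, g, _, _, hM⟩ ⟨N, f', g', _, _, hN⟩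
  exact ⟨pullback g f', pullback.fst _ _ ≫ f, pullback.snd _ _ ≫ g', mono_comp _ _, mono_comp _ _,
    h.not_isZero_pullback g f' hM hN⟩

lemma atom_eq_iff {H H' : D} {h : Monoform H} {h' : Monoform H'} :
    atom H h = atom H' h' ↔ AtomEquiv H H' := by
  refine ⟨fun he => ?_, fun he => Quot.sound he⟩
  have key : Equivalence fun K K' : {K : D // Monoform K} => AtomEquiv K.1 K'.1 :=
    ⟨fun K => .of_mono (𝟙 _) K.2.1, AtomEquiv.symm, fun {_ K _} => AtomEquiv.trans K.2⟩
  exact key.eqvGen_iff.1 (Quot.eqvGen_exact he)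

lemma exists_atom (x : ASpec D) : ∃ (H : D) (h : Monoform H), atom H h = x :=
  Quot.inductionOn x fun H => ⟨H.1, H.2, rfl⟩

/-- The atom support, described through subquotients `M ↢ L ↠ H`. -/
lemma mem_ASupp_iff {M : D} {x : ASpec D} : x ∈ ASupp M ↔
    ∃ (H : D) (h : Monoform H), atom H h = x ∧
      ∃ (L : D) (i : L ⟶ M) (p : L ⟶ H), Mono i ∧ Epi p := by
  constructor
  · rintro ⟨H, h, rfl, L, L', ⟨e⟩⟩
    exact ⟨H, h, rfl, L, L.arrow, cokernel.π L'.arrow ≫ e.inv, inferInstance, epi_comp _ _⟩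
  · rintro ⟨H, h, rfl, L, i, p, _, _⟩
    let q := (Subobject.underlyingIso i).hom ≫ p
    obtain ⟨e⟩ := nonempty_iso_of_shortExact (shortExact_kernel q)
      (shortExact_cokernel (Subobject.mk (kernel.ι q)).arrow)
      (Subobject.underlyingIso _).symm (by simp)
    exact ⟨H, h, rfl, Subobject.mk i, Subobject.mk (kernel.ι q), ⟨e⟩⟩

lemma ASupp_subset_of_mono {M M' : D} (j : M ⟶ M') [Mono j] : ASupp M ⊆ ASupp M' := by
  intro x hx
  obtain ⟨H, h, rfl, L, i, p, _, hp⟩ := mem_ASupp_iff.1 hx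
  exact mem_ASupp_iff.2 ⟨H, h, rfl, L, i ≫ j, p, mono_comp _ _, hp⟩

end Basic

section Functor

variable {A D : Type*} [Category A] [Category D] [Abelian A] [Abelian D] {S : A ⥤ D}

open ZeroObject in
lemma preservesZeroMorphisms_of_isZero (h : IsZero (S.obj 0)) : S.PreservesZeroMorphisms :=
  Functor.preservesZeroMorphisms_of_map_zero_object h.isoZero

lemma shortExact_map {_ : S.PreservesZeroMorphisms} (T : ShortComplex A)
    (hf : Mono (S.map T.f)) (hg : Epi (S.map T.g))
    (h : ∀ (W : D) (k : W ⟶ S.obj T.X₂), k ≫ S.map T.g = 0 → ∃ l, l ≫ S.map T.f = k) :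
    (T.map S).ShortExact :=
  .mk' (ShortComplex.exact_of_f_is_kernel _ (KernelFork.IsLimit.ofι' (S.map T.f) _
    fun k hk => ⟨(h _ k hk).choose, (h _ k hk).choose_spec⟩)) hf hg

variable (S) in
/-- A fully faithful functor that preserves short exact sequences and lifts subobjects. -/
structure IsSubobjectClosedEmbedding : Prop where
  full : S.Full
  faithful : S.Faithful
  [preservesZeroMorphisms : S.PreservesZeroMorphisms]
  map_shortExact : ∀ T : ShortComplex A, T.ShortExact → (T.map S).ShortExact
  lifts : S.LiftsSubobjects

namespace IsSubobjectClosedEmbedding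

variable (hS : IsSubobjectClosedEmbedding S)
include hS

lemma mono_map {X Y : A} (f : X ⟶ Y) [Mono f] : Mono (S.map f) :=
  (hS.map_shortExact _ (shortExact_cokernel f)).mono_f

lemma epi_map {X Y : A} (f : X ⟶ Y) [Epi f] : Epi (S.map f) :=
  (hS.map_shortExact _ (shortExact_kernel f)).epi_g

lemma isZero_map_iff {X : A} : IsZero (S.obj X) ↔ IsZero X := by
  have := hS.faithful
  have := hS.preservesZeroMorphisms
  simp only [IsZero.iff_id_eq_zero, ← S.map_id, S.map_eq_zero_iff]

lemma exists_mono_of_mono {X Y : A} (f : S.obj X ⟶ S.obj Y) [Mono f] : ∃ g : X ⟶ Y, Mono g := by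
  have := hS.full
  have := hS.faithful
  refine ⟨S.preimage f, S.mono_of_mono_map ?_⟩
  rwa [S.map_preimage]

lemma monoform_map_iff {H : A} : Monoform (S.obj H) ↔ Monoform H := by
  rw [monoform_iff, monoform_iff, hS.isZero_map_iff]
  refine and_congr_right fun _ => ⟨fun h N Q i p w hs hN X f g _ _ => ?_,
    fun h N Q i p w hs hN X f g hf _ => ?_⟩
  · exact hS.isZero_map_iff.1 (h _ _ _ _ _ (hS.map_shortExact _ hs)
      (fun hz => hN (hS.isZero_map_iff.1 hz)) _ (S.map f) (S.map g) (hS.mono_map f) (hS.mono_map g))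
  · obtain ⟨N', i', _, e, he⟩ := hS.lifts _ _ i hs.mono_f
    obtain ⟨X', f', _, e', -⟩ := hS.lifts _ _ f hf
    obtain ⟨e''⟩ := nonempty_iso_of_shortExact hs (hS.map_shortExact _ (shortExact_cokernel i')) e he
    obtain ⟨g', _⟩ := hS.exists_mono_of_mono (X := X') (Y := cokernel i') (e'.inv ≫ g ≫ e''.hom)
    exact (hS.isZero_map_iff.2 (h _ _ i' _ _ (shortExact_cokernel i')
      (fun hz => hN ((hS.isZero_map_iff.2 hz).of_iso e)) X' f' g' ‹_› ‹_›)).of_iso e'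

lemma atomEquiv_map_iff {H H' : A} : AtomEquiv (S.obj H) (S.obj H') ↔ AtomEquiv H H' := by
  constructor
  · rintro ⟨M, f, g, hf, _, hM⟩
    obtain ⟨M', f', hf', e, -⟩ := hS.lifts _ _ f hf
    obtain ⟨g', hg'⟩ := hS.exists_mono_of_mono (X := M') (Y := H') (e.inv ≫ g)
    exact ⟨M', f', g', hf', hg', fun hz => hM ((hS.isZero_map_iff.2 hz).of_iso e)⟩
  · rintro ⟨M, f, g, _, _, hM⟩
    exact ⟨S.obj M, S.map f, S.map g, hS.mono_map f, hS.mono_map g,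
      fun hz => hM (hS.isZero_map_iff.1 hz)⟩

/-- The map on atom spectra `⟨H⟩ ↦ ⟨S H⟩`. -/
def mapASpec : ASpec A → ASpec D :=
  Quot.lift (fun H => atom (S.obj H.1) (hS.monoform_map_iff.2 H.2))
    fun _ _ h => atom_eq_iff.2 (hS.atomEquiv_map_iff.2 h)

lemma mapASpec_atom {H : A} (h : Monoform H) :
    hS.mapASpec (atom H h) = atom (S.obj H) (hS.monoform_map_iff.2 h) := rfl

lemma injective_mapASpec : Function.Injective hS.mapASpec := by
  intro x y hxy
  obtain ⟨H, h, rfl⟩ := exists_atom x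
  obtain ⟨H', h', rfl⟩ := exists_atom y
  rw [mapASpec_atom, mapASpec_atom, atom_eq_iff, hS.atomEquiv_map_iff] at hxy
  exact atom_eq_iff.2 hxy

lemma ASupp_map (M : A) : ASupp (S.obj M) = hS.mapASpec '' ASupp M := by
  ext x
  constructor
  · intro hx
    obtain ⟨H, h, rfl, L, i, p, hi, _⟩ := mem_ASupp_iff.1 hx
    obtain ⟨L', i', _, e, he⟩ := hS.lifts _ _ i hi
    let q := e.inv ≫ p
    obtain ⟨K, k, _, d, hd⟩ := hS.lifts _ _ (kernel.ι q) inferInstance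
    obtain ⟨c⟩ := nonempty_iso_of_shortExact (shortExact_kernel q)
      (hS.map_shortExact _ (shortExact_cokernel k)) d hd
    have hc : Monoform (S.obj (cokernel k)) :=
      h.of_mono c.inv fun hz => h.1 (hz.of_iso c)
    refine ⟨atom _ (hS.monoform_map_iff.1 hc), mem_ASupp_iff.2
      ⟨_, _, rfl, L', i', cokernel.π k, inferInstance, inferInstance⟩, ?_⟩
    rw [mapASpec_atom, atom_eq_iff]
    exact .of_mono c.inv hc.1
  · rintro ⟨x, hx, rfl⟩
    obtain ⟨H, h, rfl, L, i, p, _, _⟩ := mem_ASupp_iff.1 hx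
    exact mem_ASupp_iff.2 ⟨_, _, rfl, S.obj L, S.map i, S.map p, hS.mono_map i, hS.epi_map p⟩

lemma continuous_mapASpec : Continuous hS.mapASpec := by
  refine continuous_generateFrom_iff.2 fun Φ hΦ => .basic _ fun H h hH => ?_
  obtain ⟨K, hK, ⟨M, f, g, _, hg, hM⟩, hsub⟩ := hΦ _ _ hH
  obtain ⟨M', g', _, e, -⟩ := hS.lifts _ _ g hg
  have hM' : ¬ IsZero M' := fun hz => hM ((hS.isZero_map_iff.2 hz).of_iso e)
  refine ⟨M', h.of_mono g' hM', .of_mono g' hM', fun x hx => hsub ?_⟩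
  have hx' : hS.mapASpec x ∈ ASupp (S.obj M') := hS.ASupp_map M' ▸ Set.mem_image_of_mem _ hx
  exact ASupp_subset_of_mono (e.inv ≫ f) hx'

lemma isOpenMap_mapASpec : IsOpenMap hS.mapASpec := by
  have basic : ∀ Φ : Set (ASpec A), (∀ (H : A) (h : Monoform H), atom H h ∈ Φ →
      ∃ (H' : A) (_ : Monoform H'), AtomEquiv H' H ∧ ASupp H' ⊆ Φ) →
      IsOpen (hS.mapASpec '' Φ) := by
    refine fun Φ hΦ => .basic _ fun K hK => ?_
    rintro ⟨x, hx, hxK⟩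
    obtain ⟨H, h, rfl⟩ := exists_atom x
    obtain ⟨H', h', he, hsub⟩ := hΦ H h hx
    rw [mapASpec_atom, atom_eq_iff] at hxK
    refine ⟨S.obj H', hS.monoform_map_iff.2 h',
      (hS.atomEquiv_map_iff.2 he).trans (hS.monoform_map_iff.2 h) hxK, ?_⟩
    rw [hS.ASupp_map]
    exact Set.image_mono hsub
  intro Φ hΦ
  induction hΦ with
  | basic Φ hΦ => exact basic Φ hΦ
  | univ => exact basic _ fun H h _ => ⟨H, h, .of_mono (𝟙 H) h.1, Set.subset_univ _⟩
  | inter s t _ _ hs ht =>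
    rw [Set.image_inter hS.injective_mapASpec]
    exact hs.inter ht
  | sUnion c _ hc =>
    rw [Set.sUnion_eq_biUnion, Set.image_iUnion₂]
    exact isOpen_biUnion hc

end IsSubobjectClosedEmbedding

end Functor

end AtomSpectrum

namespace CommaAbelian

open AtomSpectrum ZeroObject

variable {A B C : Type*} [Category A] [Category B] [Category C]
variable {U : A ⥤ C} {V : B ⥤ C}

lemma mono_of_left_right {X Y : Comma U V} (f : X ⟶ Y) [Mono f.left] [Mono f.right] : Mono f where
  right_cancellation _ _ h := CommaMorphism.ext
    ((cancel_mono f.left).1 (congrArg CommaMorphism.left h))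
    ((cancel_mono f.right).1 (congrArg CommaMorphism.right h))

lemma epi_of_left_right {X Y : Comma U V} (f : X ⟶ Y) [Epi f.left] [Epi f.right] : Epi f where
  left_cancellation _ _ h := CommaMorphism.ext
    ((cancel_epi f.left).1 (congrArg CommaMorphism.left h))
    ((cancel_epi f.right).1 (congrArg CommaMorphism.right h))

variable [Abelian A] [Abelian B] [Abelian C] [U.Additive] [V.Additive]

lemma isZero_of_left_right {X : Comma U V} (hl : IsZero X.left) (hr : IsZero X.right) :
    IsZero X where
  unique_to Y := ⟨⟨⟨{ left := 0, right := 0, w := by simp }⟩, fun _ =>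
    CommaMorphism.ext (hl.eq_of_src _ _) (hr.eq_of_src _ _)⟩⟩
  unique_from Y := ⟨⟨⟨{ left := 0, right := 0, w := by simp }⟩, fun _ =>
    CommaMorphism.ext (hl.eq_of_tgt _ _) (hr.eq_of_tgt _ _)⟩⟩

variable (U V) in
lemma isZero_stalkLeft_zero : IsZero ((stalkLeft U V).obj 0) :=
  isZero_of_left_right (isZero_zero A) (isZero_zero B)

lemma isZero_iff {X : Comma U V} : IsZero X ↔ IsZero X.left ∧ IsZero X.right := by
  refine ⟨fun h => ?_, fun h => isZero_of_left_right h.1 h.2⟩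
  let e := h.iso (isZero_stalkLeft_zero U V)
  exact ⟨(isZero_zero A).of_iso ((Comma.fst U V).mapIso e),
    (isZero_zero B).of_iso ((Comma.snd U V).mapIso e)⟩

lemma left_eq_zero {X Y : Comma U V} {f : X ⟶ Y}
    (hf : ∀ Z, ∃ (a : X ⟶ Z) (b : Z ⟶ Y), a ≫ b = f) : f.left = 0 := by
  obtain ⟨a, b, rfl⟩ := hf ((stalkLeft U V).obj 0)
  have hb : b.left = 0 := (isZero_zero A).eq_of_src _ _
  rw [Comma.comp_left, hb, comp_zero]

lemma right_eq_zero {X Y : Comma U V} {f : X ⟶ Y}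
    (hf : ∀ Z, ∃ (a : X ⟶ Z) (b : Z ⟶ Y), a ≫ b = f) : f.right = 0 := by
  obtain ⟨a, b, rfl⟩ := hf ((stalkLeft U V).obj 0)
  have hb : b.right = 0 := (isZero_zero B).eq_of_src _ _
  rw [Comma.comp_right, hb, comp_zero]

/-- The inclusion of the right component into an object of the comma category. -/
noncomputable def stalkRightι (X : Comma U V) : (stalkRight U V).obj X.right ⟶ X where
  left := 0
  right := 𝟙 _
  w := (U.map_isZero (isZero_zero A)).eq_of_src _ _

instance (X : Comma U V) : Mono (stalkRightι X) := by
  have : Mono (stalkRightι X).left := ⟨fun _ _ _ => (isZero_zero A).eq_of_tgt _ _⟩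
  have : Mono (stalkRightι X).right := inferInstanceAs (Mono (𝟙 X.right))
  exact mono_of_left_right _

lemma mono_right {X Y : Comma U V} (f : X ⟶ Y) [Mono f] : Mono f.right where
  right_cancellation u v h := by
    have key : (stalkRight U V).map u ≫ stalkRightι X = (stalkRight U V).map v ≫ stalkRightι X := by
      rw [← cancel_mono f]
      refine CommaMorphism.ext ((isZero_zero A).eq_of_src _ _) ?_
      simpa [stalkRight, stalkRightι] using h
    simpa [stalkRight, stalkRightι] using congrArg CommaMorphism.right key

/-- A morphism from a left stalk, given by a morphism killed by the structure map. -/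
noncomputable def stalkLeftDesc {W : A} {X : Comma U V} (u : W ⟶ X.left)
    (hu : U.map u ≫ X.hom = 0) : (stalkLeft U V).obj W ⟶ X where
  left := u
  right := 0
  w := by simpa [stalkLeft] using hu

lemma mono_left [PreservesFiniteLimits V] {X Y : Comma U V} (f : X ⟶ Y) [Mono f] :
    Mono f.left := by
  refine Preadditive.mono_of_cancel_zero _ fun {W} u hu => ?_
  have := mono_right f
  have hX : U.map u ≫ X.hom = 0 := by
    rw [← cancel_mono (V.map f.right), Category.assoc, ← f.w, ← Category.assoc, ← U.map_comp, hu]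
    simp
  have h0 : U.map (0 : W ⟶ X.left) ≫ X.hom = 0 := by simp
  have key : stalkLeftDesc u hX = stalkLeftDesc 0 h0 := by
    rw [← cancel_mono f]
    exact CommaMorphism.ext (hu.trans zero_comp.symm) ((isZero_zero B).eq_of_src _ _)
  exact congrArg CommaMorphism.left key

/-- No atom comes from both stalk functors. -/
lemma not_atomEquiv_stalk [PreservesFiniteLimits V] (X : A) (Y : B) :
    ¬ AtomEquiv ((stalkLeft U V).obj X) ((stalkRight U V).obj Y) := by
  rintro ⟨M, f, g, _, _, hM⟩
  have := mono_right f
  have := mono_left g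
  exact hM (isZero_of_left_right (isZero_of_mono_to_isZero g.left (isZero_zero A))
    (isZero_of_mono_to_isZero f.right (isZero_zero B)))

variable [Abelian (Comma U V)]

variable (U V) in
lemma isSubobjectClosedEmbedding_stalkLeft [PreservesFiniteLimits V] :
    IsSubobjectClosedEmbedding (stalkLeft U V) where
  full := ⟨fun f => ⟨f.left, CommaMorphism.ext rfl ((isZero_zero B).eq_of_src _ _)⟩⟩
  faithful := ⟨fun h => congrArg CommaMorphism.left h⟩
  preservesZeroMorphisms :=
    preservesZeroMorphisms_of_isZero (isZero_of_left_right (isZero_zero A) (isZero_zero B))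
  map_shortExact T hT := by
    have := hT.mono_f
    have := hT.epi_g
    have : Mono ((stalkLeft U V).map T.f).left := inferInstanceAs (Mono T.f)
    have : Mono ((stalkLeft U V).map T.f).right := inferInstanceAs (Mono (𝟙 (0 : B)))
    have : Epi ((stalkLeft U V).map T.g).left := inferInstanceAs (Epi T.g)
    have : Epi ((stalkLeft U V).map T.g).right := inferInstanceAs (Epi (𝟙 (0 : B)))
    have hz : ∀ X : A, IsZero (V.obj ((stalkLeft U V).obj X).right) :=
      fun _ => V.map_isZero (isZero_zero B)
    refine shortExact_map T (mono_of_left_right _) (epi_of_left_right _) fun W k hk => ?_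
    have hl : k.left ≫ T.g = 0 := left_eq_zero (exists_fac_of_eq_zero hk)
    exact ⟨{ left := hT.exact.lift k.left hl
             right := k.right
             w := (hz _).eq_of_tgt _ _ },
      CommaMorphism.ext (hT.exact.lift_f _ hl) ((isZero_zero B).eq_of_tgt _ _)⟩
  lifts X Y ι _ := by
    have := mono_right ι
    have hr : IsZero Y.right := isZero_of_mono_to_isZero ι.right (isZero_zero B)
    exact ⟨Y.left, ι.left, mono_left ι, Comma.isoMk (Iso.refl _) (hr.iso (isZero_zero B))
      ((V.map_isZero (isZero_zero B)).eq_of_tgt _ _),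
      CommaMorphism.ext (Category.id_comp _) ((isZero_zero B).eq_of_tgt _ _)⟩

variable (U V) in
lemma isSubobjectClosedEmbedding_stalkRight [PreservesFiniteLimits V] :
    IsSubobjectClosedEmbedding (stalkRight U V) where
  full := ⟨fun f => ⟨f.right, CommaMorphism.ext ((isZero_zero A).eq_of_src _ _) rfl⟩⟩
  faithful := ⟨fun h => congrArg CommaMorphism.right h⟩
  preservesZeroMorphisms :=
    preservesZeroMorphisms_of_isZero (isZero_of_left_right (isZero_zero A) (isZero_zero B))
  map_shortExact T hT := by
    have := hT.mono_f
    have := hT.epi_g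
    have : Mono ((stalkRight U V).map T.f).right := inferInstanceAs (Mono T.f)
    have : Mono ((stalkRight U V).map T.f).left := inferInstanceAs (Mono (𝟙 (0 : A)))
    have : Epi ((stalkRight U V).map T.g).right := inferInstanceAs (Epi T.g)
    have : Epi ((stalkRight U V).map T.g).left := inferInstanceAs (Epi (𝟙 (0 : A)))
    refine shortExact_map T (mono_of_left_right _) (epi_of_left_right _) fun W k hk => ?_
    have hr : k.right ≫ T.g = 0 := right_eq_zero (exists_fac_of_eq_zero hk)
    have hk' : hT.exact.lift k.right hr ≫ T.f = k.right := hT.exact.lift_f _ hr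
    refine ⟨{ left := k.left
              right := hT.exact.lift k.right hr
              w := ?_ },
      CommaMorphism.ext ((isZero_zero A).eq_of_tgt _ _) hk'⟩
    change U.map k.left ≫ 0 = W.hom ≫ V.map (hT.exact.lift k.right hr)
    rw [comp_zero, ← cancel_mono (V.map T.f), zero_comp, Category.assoc, ← V.map_comp, hk']
    exact comp_zero.symm.trans k.w
  lifts X Y ι _ := by
    have := mono_left ι
    have hl : IsZero Y.left := isZero_of_mono_to_isZero ι.left (isZero_zero A)
    exact ⟨Y.right, ι.right, mono_right ι, Comma.isoMk (hl.iso (isZero_zero A)) (Iso.refl _)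
      ((U.map_isZero hl).eq_of_src _ _),
      CommaMorphism.ext ((isZero_zero A).eq_of_tgt _ _) (Category.id_comp _)⟩

/-- An object with vanishing right component is a left stalk. -/
noncomputable def isoStalkLeft {X : Comma U V} (h : IsZero X.right) :
    (stalkLeft U V).obj X.left ≅ X :=
  Comma.isoMk (Iso.refl _) ((isZero_zero B).iso h) ((V.map_isZero h).eq_of_tgt _ _)

/-- A monoform object of the comma category is atom equivalent to a stalk at a monoform object. -/
lemma exists_atomEquiv_stalk [PreservesFiniteLimits V] {X : Comma U V} (hX : Monoform X) :
    (∃ H : A, Monoform H ∧ AtomEquiv ((stalkLeft U V).obj H) X) ∨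
      ∃ H : B, Monoform H ∧ AtomEquiv ((stalkRight U V).obj H) X := by
  by_cases h : IsZero X.right
  · have h0 : ¬ IsZero ((stalkLeft U V).obj X.left) :=
      fun hz => hX.1 (hz.of_iso (isoStalkLeft h).symm)
    exact .inl ⟨X.left, (isSubobjectClosedEmbedding_stalkLeft U V).monoform_map_iff.1
      (hX.of_mono (isoStalkLeft h).hom h0), .of_mono (isoStalkLeft h).hom h0⟩
  · have h0 : ¬ IsZero ((stalkRight U V).obj X.right) := fun hz => h (isZero_iff.1 hz).2
    exact .inr ⟨X.right, (isSubobjectClosedEmbedding_stalkRight U V).monoform_map_iff.1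
      (hX.of_mono (stalkRightι X) h0), .of_mono (stalkRightι X) h0⟩

end CommaAbelian

/-- **Theorem B.** Let `A, B, C` be abelian categories and
`U : A ⥤ C`, `V : B ⥤ C` functors where `U` has a right adjoint and `V` is left exact (so
that the comma category `(U ↓ V)` is abelian).  The map
`f : ASpec A ⊔ ASpec B → ASpec (U ↓ V)` given by `⟨H⟩ ↦ ⟨S_A H⟩` on `ASpec A` and
`⟨H⟩ ↦ ⟨S_B H⟩` on `ASpec B` is a homeomorphism for the localization topologies and an
order-isomorphism for the specialization orders. -/
theorem aspec_comma_homeomorph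
    {A B C : Type*} [Category A] [Category B] [Category C]
    [Abelian A] [Abelian B] [Abelian C]
    (U : A ⥤ C) (V : B ⥤ C) [U.Additive] [V.Additive]
    (U' : C ⥤ A) (adjU : U ⊣ U')
    (hV : Nonempty (PreservesFiniteLimits V))
    [Abelian (Comma U V)] :
    ∃ f : ASpec A ⊕ ASpec B → ASpec (Comma U V),
      (∀ (H : A) (h : Monoform H),
        ∃ h' : Monoform ((stalkLeft U V).obj H),
          f (Sum.inl (atom H h)) = atom ((stalkLeft U V).obj H) h') ∧
      (∀ (H : B) (h : Monoform H),
        ∃ h' : Monoform ((stalkRight U V).obj H),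
          f (Sum.inr (atom H h)) = atom ((stalkRight U V).obj H) h') ∧
      IsHomeomorph f ∧
      (∀ x y : ASpec A ⊕ ASpec B, x ∈ closure {y} ↔ f x ∈ closure {f y}) := by
  obtain ⟨_⟩ := hV
  have hA := isSubobjectClosedEmbedding_stalkLeft U V
  have hB := isSubobjectClosedEmbedding_stalkRight U V
  have hf : IsHomeomorph (Sum.elim hA.mapASpec hB.mapASpec) := by
    refine ⟨continuous_sum_dom.2 ⟨hA.continuous_mapASpec, hB.continuous_mapASpec⟩,
      hA.isOpenMap_mapASpec.sumElim hB.isOpenMap_mapASpec,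
      hA.injective_mapASpec.sumElim hB.injective_mapASpec fun x y hxy => ?_, fun z => ?_⟩
    · obtain ⟨H, h, rfl⟩ := exists_atom x
      obtain ⟨H', h', rfl⟩ := exists_atom y
      rw [hA.mapASpec_atom, hB.mapASpec_atom, atom_eq_iff] at hxy
      exact not_atomEquiv_stalk H H' hxy
    · obtain ⟨X, hX, rfl⟩ := exists_atom z
      obtain ⟨H, h, he⟩ | ⟨H, h, he⟩ := exists_atomEquiv_stalk hX
      · exact ⟨.inl (atom H h), atom_eq_iff.2 he⟩
      · exact ⟨.inr (atom H h), atom_eq_iff.2 he⟩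
  refine ⟨_, fun H h => ⟨hA.monoform_map_iff.2 h, rfl⟩, fun H h => ⟨hB.monoform_map_iff.2 h, rfl⟩,
    hf, fun x y => ?_⟩
  rw [← specializes_iff_mem_closure, ← specializes_iff_mem_closure,
    hf.isInducing.specializes_iff]
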